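/- Let M be a complex vector space with a linear map Y_M(·,x) satisfying the truncation condition and the twisted Jacobi identity. Then for every u, v ∈ V and w ∈ M there exist k(u,v) ∈ ℕ, l(u,w) ∈ (1/p)ℕ, and a (nonunique) element F(u,v,w;x_0,x_1,x_2) of M((x_0,x_1^{1/p},x_2^{1/p})) such that x_0^{k(u,v)} F(u,v,w;x_0,x_1,x_2) ∈ M[[x_0]]((x_1^{1/p},x_2^{1/p})), x_1^{l(u,w)} F(u,v,w;x_0,x_1,x_2) ∈ M[[x_1^{1/p}]]((x_0,x_2^{1/p})), and Y_M(u,x_1)Y_M(v,x_2)w = F(u,v,w;x_1−x_2,x_1,x_2), Y_M(v,x_2)Y_M(u,x_1)w = F(u,v,w;−x_2+x_1,x_1,x_2), and for every s ∈ ℤ, Y_M(Y(ν^{−s}u,x_0)v,x_2)w = lim_{x_1^{1/p} → ω_p^s (x_2+x_0)^{1/p}} F(u,v,w;x_0,x_1,x_2), all substitutions taken with the binomial expansion convention. Conversely, if M is a complex vector space with a linear map Y_M(·,x) satisfying the truncation condition, and if for every u, v ∈ V and w ∈ M such an F exists with the above pole conditions and identities (k(u,v) ∈ ℕ and l(u,w)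 ∈ (1/p)ℕ now allowed to depend on all three of u, v, w), then the twisted Jacobi identity holds. -/

import Mathlib

noncomputable section

open scoped BigOperators

/-- Generalized binomial coefficient `z(z-1)⋯(z-k+1)/k!`. -/
def cbinom (z : ℂ) (k : ℕ) : ℂ :=
  (∏ j ∈ Finset.range k, (z - (j : ℂ))) / (k.factorial : ℂ)

/-- Generalized binomial coefficient with integer lower index (zero for negative index). -/
def cbinomZ (z : ℂ) (k : ℤ) : ℂ := if 0 ≤ k then cbinom z k.toNat else 0

/-- A vertex operator algebra `(V, Y, 𝟙, ω)` over `ℂ`, described in terms of the modes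
`vₙ = Y v n` of the vertex operators `Y(v,x) = ∑ₙ vₙ x^{-n-1}`.  The Jacobi identity is
expressed in its equivalent component (Borcherds identity) form: it is the equality of the
coefficients of `x₀^{-n-1} x₁^{-a-1} x₂^{-b-1}` on the two sides of the formal-variable
Jacobi identity, with all binomials expanded by the binomial expansion convention. -/
structure VOA (V : Type) [AddCommGroup V] [Module ℂ V] where
  Y : V →ₗ[ℂ] ℤ → Module.End ℂ V
  vac : V
  conf : V
  cc : ℂ
  grade : ℤ → Submodule ℂ V
  internal : DirectSum.IsInternal grade
  findim : ∀ n : ℤ, FiniteDimensional ℂ (grade n)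
  bddBelow : ∃ N : ℤ, ∀ n < N, grade n = ⊥
  trunc : ∀ u v : V, ∃ N : ℤ, ∀ n ≥ N, Y u n v = 0
  vacuum : ∀ n : ℤ, Y vac n = if n = -1 then 1 else 0
  creation_zero : ∀ (v : V) (n : ℤ), 0 ≤ n → Y v n vac = 0
  creation_id : ∀ v : V, Y v (-1) vac = v
  virasoro : ∀ m n : ℤ,
    Y conf (m + 1) * Y conf (n + 1) - Y conf (n + 1) * Y conf (m + 1)
      = ((m - n : ℤ) : ℂ) • Y conf (m + n + 1)
        + (if m + n = 0 then ((m ^ 3 - m : ℤ) : ℂ) / 12 * cc else 0) •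
            (1 : Module.End ℂ V)
  L0_grade : ∀ n : ℤ, ∀ v ∈ grade n, Y conf 1 v = (n : ℂ) • v
  L_neg_one : ∀ (u : V) (n : ℤ), Y (Y conf 0 u) n = (-n : ℂ) • Y u (n - 1)
  jacobi : ∀ (u v w : V) (a n b : ℤ),
    (∑ᶠ i : ℕ, cbinom (a : ℂ) i • Y (Y u (n + i) v) (a + b - i) w)
      = (∑ᶠ i : ℕ, ((-1 : ℂ) ^ i * cbinom (n : ℂ) i) • Y u (a + n - i) (Y v (b + i) w))
        - (-1 : ℂ) ^ n •
            (∑ᶠ i : ℕ, ((-1 : ℂ) ^ i * cbinom (n : ℂ) i) • Y v (b + n - i) (Y u (a + i) w))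

variable {V W : Type} [AddCommGroup V] [Module ℂ V] [AddCommGroup W] [Module ℂ W]

/-- Truncation condition for a module-type vertex operator map. -/
def TruncW (YW : V →ₗ[ℂ] ℤ → Module.End ℂ W) : Prop :=
  ∀ (v : V) (w : W), ∃ N : ℤ, ∀ n ≥ N, YW v n w = 0

/-- The Jacobi identity for a module map `Y_W`, in component form. -/
def JacobiW (𝒜 : VOA V) (YW : V →ₗ[ℂ] ℤ → Module.End ℂ W) : Prop :=
  ∀ (u v : V) (w : W) (a n b : ℤ),
    (∑ᶠ i : ℕ, cbinom (a : ℂ) i • YW (𝒜.Y u (n + i) v) (a + b - i) w)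
      = (∑ᶠ i : ℕ, ((-1 : ℂ) ^ i * cbinom (n : ℂ) i) • YW u (a + n - i) (YW v (b + i) w))
        - (-1 : ℂ) ^ n •
            (∑ᶠ i : ℕ, ((-1 : ℂ) ^ i * cbinom (n : ℂ) i) • YW v (b + n - i) (YW u (a + i) w))

section Twisted

variable {V M : Type} [AddCommGroup V] [Module ℂ V] [AddCommGroup M] [Module ℂ M]

/-- Truncation condition for a twisted-module-type vertex operator map.  Here, for a fixed
period `p`, the map `Y_M` is encoded by its modes in `(1/p)ℤ`, rescaled by `p`:
`YM v N` is the mode `v^ν_{N/p}`, the coefficient of `x^{-N/p-1}` in `Y_M(v,x)`. -/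
def TwTrunc (YM : V →ₗ[ℂ] ℤ → Module.End ℂ M) : Prop :=
  ∀ (v : V) (w : M), ∃ N : ℤ, ∀ n ≥ N, YM v n w = 0

/-- The twisted Jacobi identity in component form: the equality of the coefficients of
`x₀^{-n-1} x₁^{-a/p-1} x₂^{-b/p-1}` on the two sides of the twisted Jacobi identity,
with all binomials expanded by the binomial expansion convention. -/
def TwJacobi (p : ℕ) (𝒜 : VOA V) (ν : V ≃ₗ[ℂ] V) (ωp : ℂ)
    (YM : V →ₗ[ℂ] ℤ → Module.End ℂ M) : Prop :=
  ∀ (u v : V) (w : M) (n a b : ℤ),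
    (∑ᶠ i : ℕ, ((-1 : ℂ) ^ i * cbinom (n : ℂ) i) •
        YM u (a + (p : ℤ) * (n - i)) (YM v (b + (p : ℤ) * i) w))
      - (-1 : ℂ) ^ n •
          (∑ᶠ i : ℕ, ((-1 : ℂ) ^ i * cbinom (n : ℂ) i) •
            YM v (b + (p : ℤ) * (n - i)) (YM u (a + (p : ℤ) * i) w))
      = (p : ℂ)⁻¹ • ∑ r ∈ Finset.range p, ωp ^ (-(r : ℤ) * a) •
          (∑ᶠ i : ℕ, cbinom ((a : ℂ) / (p : ℂ)) i •
            YM (𝒜.Y ((ν ^ r) u) (n + i) v) (a + b - (p : ℤ) * i) w)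

/-- Weak commutativity for twisted vertex operators with exponent `k`:
`(x₁-x₂)^k Y_M(u,x₁)Y_M(v,x₂) = (x₁-x₂)^k Y_M(v,x₂)Y_M(u,x₁)`, as the equality of the
coefficients of `x₁^{a/p} x₂^{b/p}` (endomorphism-valued). -/
def TwWC (p : ℕ) (YM : V →ₗ[ℂ] ℤ → Module.End ℂ M) (k : ℕ) (u v : V) : Prop :=
  ∀ a b : ℤ,
    (∑ᶠ i : ℕ, ((-1 : ℂ) ^ i * cbinom (k : ℂ) i) •
        (YM u ((p : ℤ) * ((k : ℤ) - i) - a - p) * YM v ((p : ℤ) * i - b - p)))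
      = ∑ᶠ i : ℕ, ((-1 : ℂ) ^ i * cbinom (k : ℂ) i) •
          (YM v ((p : ℤ) * i - b - p) * YM u ((p : ℤ) * ((k : ℤ) - i) - a - p))

/-- Modified weak associativity for twisted vertex operators with exponent `k`:
`lim_{x₁^{1/p} → ωₚ^s (x₂+x₀)^{1/p}} ((x₁-x₂)^k Y_M(u,x₁)Y_M(v,x₂))
   = x₀^k Y_M(Y(ν^{-s}u,x₀)v,x₂)` for all `s ∈ ℤ`, stated as the equality of the
coefficients of `x₀^n x₂^{C/p}` applied to an arbitrary vector `w`.  In the formal limit,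
each integral power of `x₁^{1/p}` is replaced by the corresponding binomially expanded
power of `ωₚ^s (x₂+x₀)^{1/p}`. -/
def TwMWA (p : ℕ) (𝒜 : VOA V) (ν : V ≃ₗ[ℂ] V) (ωp : ℂ)
    (YM : V →ₗ[ℂ] ℤ → Module.End ℂ M) (k : ℕ) (u v : V) : Prop :=
  ∀ (s n C : ℤ) (w : M),
    (∑ᶠ a : ℤ, (ωp ^ (s * a) * cbinomZ ((a : ℂ) / (p : ℂ)) n) •
        (∑ᶠ i : ℕ, ((-1 : ℂ) ^ i * cbinom (k : ℂ) i) •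
          YM u ((p : ℤ) * ((k : ℤ) - i) - a - p)
            (YM v ((p : ℤ) * i - (C - a + (p : ℤ) * n) - p) w)))
      = YM (𝒜.Y ((ν ^ (-s)) u) ((k : ℤ) - n - 1) v) (-C - p) w

end Twisted

section S3

variable {V M : Type} [AddCommGroup V] [Module ℂ V] [AddCommGroup M] [Module ℂ M]

/-- `F ∈ M((x₀,x₁^{1/p},x₂^{1/p}))`: `F n₀ N₁ N₂` is the coefficient of
`x₀^{n₀} x₁^{N₁/p} x₂^{N₂/p}`, and there are only finitely many negative powers of each
variable, with a common bound. -/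
def TwIsLaurent3 (F : ℤ → ℤ → ℤ → M) : Prop :=
  ∃ N : ℕ, ∀ n0 N1 N2 : ℤ, (n0 < -(N : ℤ) ∨ N1 < -(N : ℤ) ∨ N2 < -(N : ℤ)) → F n0 N1 N2 = 0

/-- `x₀^k F ∈ M[[x₀]]((x₁^{1/p},x₂^{1/p}))`. -/
def TwPole0 (k : ℕ) (F : ℤ → ℤ → ℤ → M) : Prop :=
  ∀ n0 N1 N2 : ℤ, n0 < -(k : ℤ) → F n0 N1 N2 = 0

/-- `x₁^{L/p} F ∈ M[[x₁^{1/p}]]((x₀,x₂^{1/p}))`, for `l = L/p ∈ (1/p)ℕ`. -/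
def TwPole1 (L : ℕ) (F : ℤ → ℤ → ℤ → M) : Prop :=
  ∀ n0 N1 N2 : ℤ, N1 < -(L : ℤ) → F n0 N1 N2 = 0

/-- `Y_M(u,x₁)Y_M(v,x₂)w = F(x₁-x₂,x₁,x₂)`: equality of coefficients of
`x₁^{N₁/p} x₂^{N₂/p}`, with `(x₁-x₂)^{n₀}` expanded in nonnegative integral powers of `x₂`. -/
def TwSubUV (p : ℕ) (YM : V →ₗ[ℂ] ℤ → Module.End ℂ M) (u v : V) (w : M)
    (F : ℤ → ℤ → ℤ → M) : Prop :=
  ∀ N1 N2 : ℤ,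
    YM u (-N1 - p) (YM v (-N2 - p) w)
      = ∑ᶠ q : ℤ × ℕ, ((-1 : ℂ) ^ q.2 * cbinom (q.1 : ℂ) q.2) •
          F q.1 (N1 - (p : ℤ) * q.1 + (p : ℤ) * q.2) (N2 - (p : ℤ) * q.2)

/-- `Y_M(v,x₂)Y_M(u,x₁)w = F(-x₂+x₁,x₁,x₂)`: equality of coefficients of
`x₁^{N₁/p} x₂^{N₂/p}`, with `(-x₂+x₁)^{n₀}` expanded in nonnegative integral powers of `x₁`. -/
def TwSubVU (p : ℕ) (YM : V →ₗ[ℂ] ℤ → Module.End ℂ M) (u v : V) (w : M)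
    (F : ℤ → ℤ → ℤ → M) : Prop :=
  ∀ N1 N2 : ℤ,
    YM v (-N2 - p) (YM u (-N1 - p) w)
      = ∑ᶠ q : ℤ × ℕ, ((-1 : ℂ) ^ (q.1 - (q.2 : ℤ)) * cbinom (q.1 : ℂ) q.2) •
          F q.1 (N1 - (p : ℤ) * q.2) (N2 - (p : ℤ) * q.1 + (p : ℤ) * q.2)

/-- For every `s ∈ ℤ`,
`Y_M(Y(ν^{-s}u,x₀)v,x₂)w = lim_{x₁^{1/p} → ωₚ^s (x₂+x₀)^{1/p}} F(x₀,x₁,x₂)`: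
equality of coefficients of `x₀^n x₂^{N₂/p}`; in the formal limit each integral power of
`x₁^{1/p}` is replaced by the corresponding binomially expanded power of
`ωₚ^s (x₂+x₀)^{1/p}` (expanded in nonnegative integral powers of `x₀`). -/
def TwSubIter (p : ℕ) (𝒜 : VOA V) (ν : V ≃ₗ[ℂ] V) (ωp : ℂ)
    (YM : V →ₗ[ℂ] ℤ → Module.End ℂ M) (u v : V) (w : M) (F : ℤ → ℤ → ℤ → M) : Prop :=
  ∀ (s : ℤ) (n N2 : ℤ),
    YM (𝒜.Y ((ν ^ (-s)) u) (-n - 1) v) (-N2 - p) w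
      = ∑ᶠ q : ℤ × ℕ, (ωp ^ (s * q.1) * cbinom ((q.1 : ℂ) / (p : ℂ)) q.2) •
          F (n - q.2) q.1 (N2 - q.1 + (p : ℤ) * q.2)

/-! ### Generalized binomial coefficients -/

lemma cbinom_eq_choose (z : ℂ) (k : ℕ) : cbinom z k = Ring.choose z k := by
  have hprod : ∀ k : ℕ, (descPochhammer ℤ k).smeval z = ∏ j ∈ Finset.range k, (z - (j : ℂ)) := by
    intro k
    induction k with
    | zero => simp
    | succ k ih =>
      rw [descPochhammer_succ_right, Polynomial.smeval_mul, ih, Finset.prod_range_succ]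
      simp [Polynomial.smeval_sub, Polynomial.smeval_natCast]
  rw [cbinom, Ring.choose_eq_smul, hprod, smul_eq_mul, div_eq_inv_mul]

lemma cbinom_zero_right (z : ℂ) : cbinom z 0 = 1 := by
  simp [cbinom]

lemma cbinom_zero_left {k : ℕ} (hk : k ≠ 0) : cbinom 0 k = 0 := by
  rw [cbinom_eq_choose]
  exact Ring.choose_zero_pos ℂ (Nat.pos_of_ne_zero hk)

lemma cbinom_add (x y : ℂ) (m : ℕ) :
    cbinom (x + y) m = ∑ k ∈ Finset.range (m + 1), cbinom x k * cbinom y (m - k) := by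
  simp only [cbinom_eq_choose]
  rw [Ring.add_choose_eq m (Commute.all x y),
    Finset.Nat.sum_antidiagonal_eq_sum_range_succ (fun i j => Ring.choose x i * Ring.choose y j)]

lemma cbinom_natCast (n k : ℕ) : cbinom (n : ℂ) k = (n.choose k : ℂ) := by
  rw [cbinom_eq_choose, Ring.choose_natCast]

lemma cbinom_neg_natCast_sub_one (n k : ℕ) :
    cbinom (-(n : ℂ) - 1) k = (-1) ^ k * ((n + k).choose k : ℂ) := by
  have h : (n : ℂ) + 1 + k - 1 = ((n + k : ℕ) : ℂ) := by push_cast; ring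
  rw [cbinom_eq_choose, show -(n : ℂ) - 1 = -((n : ℂ) + 1) by ring, Ring.choose_neg, h,
    Ring.choose_natCast, Units.smul_def, zsmul_eq_mul]
  simp [Int.negOnePow]

lemma neg_one_zpow_eq_of_even_sub {a b : ℤ} (h : Even (a - b)) : (-1 : ℂ) ^ a = (-1) ^ b := by
  rw [← sub_add_cancel a b, zpow_add₀ (by norm_num), h.neg_one_zpow, one_mul]

lemma cbinomZ_natCast (z : ℂ) (k : ℕ) : cbinomZ z k = cbinom z k := by
  simp [cbinomZ]

lemma cbinomZ_of_neg (z : ℂ) {k : ℤ} (hk : k < 0) : cbinomZ z k = 0 := by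
  simp [cbinomZ, hk]

/-- Coefficient form of
`x₀⁻¹δ((x₁-x₂)/x₀) - x₀⁻¹δ((x₂-x₁)/(-x₀)) = x₂⁻¹δ((x₁-x₀)/x₂)`. -/
lemma cbinomZ_three_term (N t : ℤ) :
    (-1 : ℂ) ^ (N + t + 1) * cbinomZ N (N + t + 1) - (-1) ^ (N + t + 1) * cbinomZ N (-t - 1)
      = cbinomZ t (-N - 1) := by
  rcases le_or_gt 0 N with hN | hN
  · lift N to ℕ using hN
    rw [cbinomZ_of_neg (t : ℂ) (by omega), ← mul_sub, mul_eq_zero, sub_eq_zero]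
    right
    push_cast
    rcases le_or_gt 0 t with ht | ht
    · lift t to ℕ using ht
      rw [cbinomZ_of_neg _ (by omega : -(t : ℤ) - 1 < 0),
        show (N : ℤ) + t + 1 = ((N + t + 1 : ℕ) : ℤ) by push_cast; rfl,
        cbinomZ_natCast, cbinom_natCast, Nat.choose_eq_zero_of_lt (by omega), Nat.cast_zero]
    · obtain ⟨T, rfl⟩ : ∃ T : ℕ, t = -(T : ℤ) - 1 := ⟨(-t - 1).toNat, by omega⟩
      rw [show -(-(T : ℤ) - 1) - 1 = (T : ℤ) by ring, cbinomZ_natCast, cbinom_natCast]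
      rcases le_or_gt T N with hT | hT
      · rw [show (N : ℤ) + (-T - 1) + 1 = ((N - T : ℕ) : ℤ) by omega, cbinomZ_natCast,
          cbinom_natCast, Nat.choose_symm hT]
      · rw [cbinomZ_of_neg _ (by omega), Nat.choose_eq_zero_of_lt hT, Nat.cast_zero]
  · obtain ⟨K, rfl⟩ : ∃ K : ℕ, N = -(K : ℤ) - 1 := ⟨(-N - 1).toNat, by omega⟩
    rw [show -(-(K : ℤ) - 1) - 1 = (K : ℤ) by ring, cbinomZ_natCast]
    push_cast
    rcases le_or_gt 0 t with ht | ht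
    · lift t to ℕ using ht
      rw [cbinomZ_of_neg _ (by omega : -(t : ℤ) - 1 < 0), Int.cast_natCast, cbinom_natCast,
        mul_zero, sub_zero]
      rcases le_or_gt K t with hK | hK
      · rw [show -(K : ℤ) - 1 + t + 1 = ((t - K : ℕ) : ℤ) by omega, cbinomZ_natCast,
          cbinom_neg_natCast_sub_one, zpow_natCast, ← mul_assoc, ← pow_add,
          Even.neg_one_pow ⟨t - K, rfl⟩, one_mul, show K + (t - K) = t by omega,
          Nat.choose_symm hK]
      · rw [cbinomZ_of_neg _ (by omega), Nat.choose_eq_zero_of_lt hK, mul_zero, Nat.cast_zero]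
    · obtain ⟨T, rfl⟩ : ∃ T : ℕ, t = -(T : ℤ) - 1 := ⟨(-t - 1).toNat, by omega⟩
      rw [cbinomZ_of_neg _ (by omega), show -(-(T : ℤ) - 1) - 1 = (T : ℤ) by ring, cbinomZ_natCast]
      push_cast
      rw [cbinom_neg_natCast_sub_one, cbinom_neg_natCast_sub_one, Nat.add_comm T K,
        ← Nat.choose_symm_add (a := K) (b := T), ← zpow_natCast, ← zpow_natCast, ← mul_assoc,
        ← zpow_add₀ (by norm_num), mul_zero, zero_sub, ← neg_mul]
      congr 1
      rw [← neg_one_mul, ← zpow_one_add₀ (by norm_num)]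
      exact neg_one_zpow_eq_of_even_sub ⟨-(K : ℤ), by ring⟩

/-! ### Finitely supported sums -/

lemma finsum_nat_eq_sum_range {A : Type} [AddCommMonoid A] {f : ℕ → A} {B : ℕ} (h : ∀ i, B ≤ i → f i = 0) :
    ∑ᶠ i, f i = ∑ i ∈ Finset.range B, f i :=
  finsum_eq_sum_of_support_subset _ fun i hi => by
    by_contra hB
    exact hi (h i (by simpa using hB))

lemma finsum_prod_nat_eq_sum {A ι : Type} [AddCommMonoid A] {f : ι × ℕ → A} {s : Finset ι} {B : ℕ}
    (h : ∀ q, f q ≠ 0 → q.1 ∈ s ∧ q.2 < B) :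
    ∑ᶠ q, f q = ∑ a ∈ s, ∑ j ∈ Finset.range B, f (a, j) := by
  rw [← Finset.sum_product']
  exact finsum_eq_sum_of_support_subset _ fun q hq => by simpa using h q hq

lemma exists_finset_bound {ι : Type} {P : ι × ℕ → Prop} (h : {q | P q}.Finite) :
    ∃ (s : Finset ι) (B : ℕ), ∀ q, P q → q.1 ∈ s ∧ q.2 < B := by
  classical
  refine ⟨h.toFinset.image Prod.fst, h.toFinset.sup Prod.snd + 1, fun q hq => ⟨?_, ?_⟩⟩
  · exact Finset.mem_image_of_mem _ (h.mem_toFinset.2 hq)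
  · exact Nat.lt_succ_of_le (Finset.le_sup (f := Prod.snd) (h.mem_toFinset.2 hq))

/-- The Chu–Vandermonde convolution, summed against a finitely supported family. -/
lemma finsum_cbinom_smul_finsum {ι : Type} (x : ℂ) (g : ι → ℂ) (f : ι → ℕ → M)
    (hf : {q : ι × ℕ | f q.1 q.2 ≠ 0}.Finite) :
    ∑ᶠ i : ℕ, cbinom x i • ∑ᶠ q : ι × ℕ, cbinom (g q.1) q.2 • f q.1 (i + q.2)
      = ∑ᶠ q : ι × ℕ, cbinom (x + g q.1) q.2 • f q.1 q.2 := by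
  obtain ⟨s, B, hB⟩ := exists_finset_bound hf
  have hz : ∀ a m, B ≤ m → f a m = 0 := fun a m hm => by
    by_contra h
    exact absurd (hB (a, m) h).2 (by simpa using hm)
  have hinner : ∀ i, ∑ᶠ q : ι × ℕ, cbinom (g q.1) q.2 • f q.1 (i + q.2)
      = ∑ a ∈ s, ∑ j ∈ Finset.range (B - i), cbinom (g a) j • f a (i + j) := fun i =>
    finsum_prod_nat_eq_sum fun q hq => by
      have h := hB (q.1, i + q.2) (right_ne_zero_of_smul hq)
      exact ⟨h.1, by have := h.2; simp only at this; omega⟩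
  simp only [hinner]
  rw [finsum_nat_eq_sum_range (B := B) (fun i hi => by simp [Nat.sub_eq_zero_of_le hi]),
    finsum_prod_nat_eq_sum (fun q hq => hB q (right_ne_zero_of_smul hq))]
  simp only [Finset.smul_sum]
  rw [Finset.sum_comm]
  refine Finset.sum_congr rfl fun a _ => ?_
  rw [← Finset.sum_range_diag_flip B fun i j => cbinom x i • cbinom (g a) j • f a (i + j)]
  refine Finset.sum_congr rfl fun m _ => ?_
  rw [cbinom_add, Finset.sum_smul]
  refine Finset.sum_congr rfl fun k hk => ?_
  rw [smul_smul, Nat.add_sub_cancel' (Nat.lt_succ_iff.1 (Finset.mem_range.1 hk))]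

lemma finsum_cbinom_smul_finsum_nat (x y : ℂ) (f : ℕ → M) {B : ℕ} (hf : ∀ m, B ≤ m → f m = 0) :
    ∑ᶠ i : ℕ, cbinom x i • ∑ᶠ j : ℕ, cbinom y j • f (i + j)
      = ∑ᶠ m : ℕ, cbinom (x + y) m • f m := by
  have e : ∀ g : ℕ → M, ∑ᶠ q : Unit × ℕ, g q.2 = ∑ᶠ j, g j := fun g =>
    finsum_comp_equiv (Equiv.punitProd ℕ) (f := g)
  have h := finsum_cbinom_smul_finsum x (fun _ : Unit => y) (fun _ => f)
    ((Set.finite_univ.prod (Set.finite_Iio B)).subset fun q hq => by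
      simp only [Set.mem_prod, Set.mem_univ, Set.mem_Iio, true_and]
      by_contra hB
      exact hq (hf _ (by omega)))
  rw [e fun j => cbinom (x + y) j • f j] at h
  rw [← h]
  exact finsum_congr fun i => by rw [e fun j => cbinom y j • f (i + j)]

lemma finsum_comp_eq_of_injective {A α β : Type} [AddCommMonoid A] {e : β → α}
    (he : Function.Injective e) {h : α → A} (hr : ∀ x, h x ≠ 0 → x ∈ Set.range e) : ∑ᶠ b, h (e b) = ∑ᶠ a, h a := by
  rw [← finsum_mem_range he, finsum_mem_inter_support_eq h _ Set.univ, finsum_mem_univ]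
  ext x
  simpa using hr x

/-! ### Roots of unity -/

lemma sum_range_zpow_mul {p : ℕ} {ωp : ℂ} (hωp : IsPrimitiveRoot ωp p) (m : ℤ) :
    ∑ r ∈ Finset.range p, ωp ^ ((r : ℤ) * m) = if (p : ℤ) ∣ m then (p : ℂ) else 0 := by
  have hpow : ∀ r : ℕ, ωp ^ ((r : ℤ) * m) = (ωp ^ m) ^ r := fun r => by
    rw [mul_comm, zpow_mul, zpow_natCast]
  simp only [hpow]
  split_ifs with h
  · simp [(hωp.zpow_eq_one_iff_dvd m).2 h]
  · have h1 : ωp ^ m ≠ 1 := fun h1 => h ((hωp.zpow_eq_one_iff_dvd m).1 h1)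
    rw [geom_sum_eq h1, ← zpow_natCast, ← zpow_mul, mul_comm m, zpow_mul, zpow_natCast,
      hωp.pow_eq_one]
    simp

/-- Inversion of the finite Fourier transform. -/
lemma eq_zero_of_sum_zpow_smul_eq_zero {p : ℕ} (hp : 0 < p) {ωp : ℂ}
    (hωp : IsPrimitiveRoot ωp p) {d : ℕ → M}
    (h : ∀ a : ℤ, ∑ r ∈ Finset.range p, ωp ^ (-(r : ℤ) * a) • d r = 0) {s : ℕ} (hs : s < p) :
    d s = 0 := by
  have hω : ωp ≠ 0 := hωp.ne_zero hp.ne'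
  have key : ∑ a ∈ Finset.range p, ωp ^ ((a : ℤ) * s) •
      ∑ r ∈ Finset.range p, ωp ^ (-(r : ℤ) * a) • d r = (p : ℂ) • d s := by
    simp only [Finset.smul_sum, smul_smul, ← zpow_add₀ hω]
    rw [Finset.sum_comm, Finset.sum_eq_single s]
    · rw [← Finset.sum_smul]
      congr 1
      have := sum_range_zpow_mul hωp 0
      simp only [dvd_zero, if_true] at this
      rw [← this]
      exact Finset.sum_congr rfl fun a _ => by congr 1; ring
    · intro r hr hrs
      rw [← Finset.sum_smul]
      have := sum_range_zpow_mul hωp ((s : ℤ) - r)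
      rw [if_neg] at this
      · rw [← zero_smul ℂ (d r), ← this]
        congr 1
        exact Finset.sum_congr rfl fun a _ => by congr 1; ring
      · intro hd
        have hlt := Finset.mem_range.1 hr
        have := Int.eq_zero_of_abs_lt_dvd hd (by rw [abs_lt]; omega)
        omega
    · exact fun h => absurd (Finset.mem_range.2 hs) h
  simp only [h, smul_zero, Finset.sum_const_zero] at key
  exact (smul_eq_zero.1 key.symm).resolve_left (by exact_mod_cast hp.ne')

/-! ### The three substitutions into a Laurent series -/

/-- The coefficient of `x₁^{-A/p-1} x₂^{-B/p-1}` in `F(x₁-x₂,x₁,x₂)`. -/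
def subUVCoeff (p : ℕ) (F : ℤ → ℤ → ℤ → M) (A B : ℤ) : M :=
  ∑ᶠ q : ℤ × ℕ, ((-1 : ℂ) ^ q.2 * cbinom (q.1 : ℂ) q.2) •
    F q.1 (-A - p - (p : ℤ) * q.1 + (p : ℤ) * q.2) (-B - p - (p : ℤ) * q.2)

/-- The coefficient of `x₁^{-A/p-1} x₂^{-B/p-1}` in `F(-x₂+x₁,x₁,x₂)`. -/
def subVUCoeff (p : ℕ) (F : ℤ → ℤ → ℤ → M) (A B : ℤ) : M :=
  ∑ᶠ q : ℤ × ℕ, ((-1 : ℂ) ^ (q.1 - (q.2 : ℤ)) * cbinom (q.1 : ℂ) q.2) •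
    F q.1 (-A - p - (p : ℤ) * q.2) (-B - p - (p : ℤ) * q.1 + (p : ℤ) * q.2)

/-- The coefficient of `x₀^{-n-1} x₂^{-c/p-1}` in
`lim_{x₁^{1/p} → ωₚ^s (x₂+x₀)^{1/p}} F(x₀,x₁,x₂)`. -/
def subIterCoeff (p : ℕ) (ωp : ℂ) (F : ℤ → ℤ → ℤ → M) (s n c : ℤ) : M :=
  ∑ᶠ q : ℤ × ℕ, (ωp ^ (s * q.1) * cbinom ((q.1 : ℂ) / (p : ℂ)) q.2) •
    F (-n - 1 - q.2) q.1 (-c - p - q.1 + (p : ℤ) * q.2)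

lemma finite_total_degree {A : Type} [AddCommGroup A] {p : ℕ} (hp : 0 < p) {F : ℤ → ℤ → ℤ → A}
    (hF : TwIsLaurent3 F) (c : ℤ) :
    {x : ℤ × ℤ | F x.1 x.2 (c - x.2 - p * x.1) ≠ 0}.Finite := by
  obtain ⟨N, hN⟩ := hF
  refine ((Set.finite_Icc (-(N : ℤ)) (|c| + 2 * N)).prod
    (Set.finite_Icc (-(N : ℤ)) (c + N + p * N))).subset fun x hx => ?_
  have h : ¬(x.1 < -(N : ℤ) ∨ x.2 < -(N : ℤ) ∨ c - x.2 - p * x.1 < -(N : ℤ)) := fun h =>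
    hx (hN _ _ _ h)
  push Not at h
  obtain ⟨h0, h1, h2⟩ := h
  have hp' : (1 : ℤ) ≤ p := by exact_mod_cast hp
  have hc := le_abs_self c
  have hc' := abs_nonneg c
  refine ⟨⟨h0, ?_⟩, ⟨h1, ?_⟩⟩
  · rcases le_or_gt x.1 0 with hx0 | hx0
    · omega
    · nlinarith
  · nlinarith

/-- Summing against Fourier coefficients selects the exponents divisible by `p`. -/
lemma sum_finsum_zpow_smul {p : ℕ} (hp : 0 < p) {ωp : ℂ} (hωp : IsPrimitiveRoot ωp p) {ι : Type}
    (e : ι → ℤ) (f : ι → M) (hf : (Function.support f).Finite) :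
    (p : ℂ)⁻¹ • ∑ r ∈ Finset.range p, ∑ᶠ q, ωp ^ ((r : ℤ) * e q) • f q
      = ∑ᶠ q, if (p : ℤ) ∣ e q then f q else 0 := by
  rw [← finsum_sum_comm _ _ fun r _ => hf.subset fun q hq => right_ne_zero_of_smul hq, smul_finsum]
  refine finsum_congr fun q => ?_
  rw [← Finset.sum_smul, sum_range_zpow_mul hωp]
  split_ifs
  · rw [inv_smul_smul₀ (by exact_mod_cast hp.ne')]
  · simp

lemma finsum_subUVCoeff {p : ℕ} (hp : 0 < p) {F : ℤ → ℤ → ℤ → M} (hF : TwIsLaurent3 F)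
    (n a b : ℤ) :
    ∑ᶠ i : ℕ, ((-1 : ℂ) ^ i * cbinom (n : ℂ) i) •
        subUVCoeff p F (a + (p : ℤ) * (n - i)) (b + (p : ℤ) * i)
      = ∑ᶠ x : ℤ × ℤ, (if (p : ℤ) ∣ a + x.2 then
          (-1 : ℂ) ^ (n + x.1 + (a + x.2) / p + 1) *
            cbinomZ ((n + x.1 : ℤ) : ℂ) (n + x.1 + (a + x.2) / p + 1) else 0) •
          F x.1 x.2 ((-a - b - 2 * p - p * n) - x.2 - p * x.1) := by
  have hp' : (p : ℤ) ≠ 0 := by exact_mod_cast hp.ne'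
  set e : ℤ × ℕ → ℤ × ℤ := fun q => (q.1, -a + p * (q.2 - (n + q.1) - 1)) with he
  have hinj : Function.Injective e := by
    rintro ⟨x, i⟩ ⟨y, j⟩ h
    simp only [he, Prod.mk.injEq, add_right_inj, mul_eq_mul_left_iff, hp', or_false] at h
    ext
    · exact h.1
    · simp only; omega
  set H : ℤ × ℤ → M := fun x => F x.1 x.2 ((-a - b - 2 * p - p * n) - x.2 - p * x.1) with hH
  have hfin := (finite_total_degree hp hF (-a - b - 2 * p - p * n)).preimage hinj.injOn
  have h1 := finsum_cbinom_smul_finsum (n : ℂ) (fun q : ℤ => (q : ℂ))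
    (fun q m => (-1 : ℂ) ^ m • H (e (q, m)))
    (hfin.subset fun q hq => right_ne_zero_of_smul hq)
  rw [← finsum_comp_eq_of_injective hinj]
  · refine Eq.trans (finsum_congr fun i => ?_) (h1.trans (finsum_congr fun q => ?_))
    · rw [subUVCoeff, mul_comm, mul_smul, smul_finsum]
      congr 1
      refine finsum_congr fun q => ?_
      rw [smul_smul, smul_smul, pow_add]
      congr 1
      · ring
      · simp only [hH, he]
        congr 1 <;> push_cast <;> ring
    · have hd : a + (e q).2 = p * (q.2 - (n + q.1) - 1) := by simp only [he]; ring
      rw [hd, if_pos (dvd_mul_right _ _), Int.mul_ediv_cancel_left _ hp', smul_smul]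
      simp only [he]
      rw [show n + q.1 + (q.2 - (n + q.1) - 1) + 1 = (q.2 : ℤ) by ring, cbinomZ_natCast,
        zpow_natCast]
      congr 1
      push_cast
      ring
  · intro x hx
    have hx := left_ne_zero_of_smul hx
    split_ifs at hx with hd
    · obtain ⟨t, ht⟩ := hd
      rw [ht, Int.mul_ediv_cancel_left _ hp'] at hx
      have hnn : 0 ≤ n + x.1 + t + 1 := by
        by_contra hneg
        exact hx (by rw [cbinomZ_of_neg _ (by omega), mul_zero])
      refine ⟨(x.1, (n + x.1 + t + 1).toNat), Prod.ext rfl ?_⟩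
      simp only [he, Int.toNat_of_nonneg hnn]
      linear_combination -ht
    · exact absurd rfl hx

lemma finsum_subVUCoeff {p : ℕ} (hp : 0 < p) {F : ℤ → ℤ → ℤ → M} (hF : TwIsLaurent3 F)
    (n a b : ℤ) :
    (-1 : ℂ) ^ n • ∑ᶠ i : ℕ, ((-1 : ℂ) ^ i * cbinom (n : ℂ) i) •
        subVUCoeff p F (a + (p : ℤ) * i) (b + (p : ℤ) * (n - i))
      = ∑ᶠ x : ℤ × ℤ, (if (p : ℤ) ∣ a + x.2 then
          (-1 : ℂ) ^ (n + x.1 + (a + x.2) / p + 1) *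
            cbinomZ ((n + x.1 : ℤ) : ℂ) (-((a + x.2) / p) - 1) else 0) •
          F x.1 x.2 ((-a - b - 2 * p - p * n) - x.2 - p * x.1) := by
  have hp' : (p : ℤ) ≠ 0 := by exact_mod_cast hp.ne'
  set e : ℤ × ℕ → ℤ × ℤ := fun q => (q.1, -a + p * (-q.2 - 1)) with he
  have hinj : Function.Injective e := by
    rintro ⟨x, i⟩ ⟨y, j⟩ h
    simp only [he, Prod.mk.injEq, add_right_inj, mul_eq_mul_left_iff, hp', or_false] at h
    ext
    · exact h.1
    · simp only; omega
  set H : ℤ × ℤ → M := fun x => F x.1 x.2 ((-a - b - 2 * p - p * n) - x.2 - p * x.1) with hH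
  have hfin := (finite_total_degree hp hF (-a - b - 2 * p - p * n)).preimage hinj.injOn
  have h1 := finsum_cbinom_smul_finsum (n : ℂ) (fun q : ℤ => (q : ℂ))
    (fun q m => (-1 : ℂ) ^ (n + q - m) • H (e (q, m)))
    (hfin.subset fun q hq => right_ne_zero_of_smul hq)
  rw [← finsum_comp_eq_of_injective hinj, smul_finsum]
  · refine Eq.trans (finsum_congr fun i => ?_) (h1.trans (finsum_congr fun q => ?_))
    · rw [subVUCoeff, smul_smul, mul_left_comm, ← mul_assoc, mul_comm, mul_smul, smul_finsum]
      congr 1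
      refine finsum_congr fun q => ?_
      have hs : (-1 : ℂ) ^ (n + q.1 - ((i + q.2 : ℕ) : ℤ))
          = (-1) ^ i * (-1) ^ n * (-1) ^ (q.1 - (q.2 : ℤ)) := by
        rw [← zpow_natCast, ← zpow_add₀ (by norm_num), ← zpow_add₀ (by norm_num)]
        exact neg_one_zpow_eq_of_even_sub ⟨-i, by push_cast; ring⟩
      rw [smul_smul, smul_smul, hs]
      congr 1
      · ring
      · simp only [hH, he]
        congr 1 <;> push_cast <;> ring
    · have hd : a + (e q).2 = p * (-q.2 - 1) := by simp only [he]; ring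
      rw [hd, if_pos (dvd_mul_right _ _), Int.mul_ediv_cancel_left _ hp', smul_smul]
      simp only [he]
      rw [show n + q.1 + (-(q.2 : ℤ) - 1) + 1 = n + q.1 - q.2 by ring,
        show -(-(q.2 : ℤ) - 1) - 1 = (q.2 : ℤ) by ring, cbinomZ_natCast]
      congr 1
      push_cast
      ring
  · intro x hx
    have hx := left_ne_zero_of_smul hx
    split_ifs at hx with hd
    · obtain ⟨t, ht⟩ := hd
      rw [ht, Int.mul_ediv_cancel_left _ hp'] at hx
      have hnn : 0 ≤ -t - 1 := by
        by_contra hneg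
        exact hx (by rw [cbinomZ_of_neg _ (by omega), mul_zero])
      refine ⟨(x.1, (-t - 1).toNat), Prod.ext rfl ?_⟩
      simp only [he, Int.toNat_of_nonneg hnn]
      linear_combination -ht
    · exact absurd rfl hx

lemma sum_finsum_subIterCoeff {p : ℕ} (hp : 0 < p) {ωp : ℂ} (hωp : IsPrimitiveRoot ωp p)
    {F : ℤ → ℤ → ℤ → M} (hF : TwIsLaurent3 F) (n a b : ℤ) :
    (p : ℂ)⁻¹ • ∑ r ∈ Finset.range p, ωp ^ (-(r : ℤ) * a) •
        ∑ᶠ i : ℕ, cbinom ((a : ℂ) / (p : ℂ)) i •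
          subIterCoeff p ωp F (-(r : ℤ)) (n + i) (a + b - (p : ℤ) * i)
      = ∑ᶠ x : ℤ × ℤ, (if (p : ℤ) ∣ a + x.2 then
          cbinomZ (((a + x.2) / p : ℤ) : ℂ) (-(n + x.1) - 1) else 0) •
          F x.1 x.2 ((-a - b - 2 * p - p * n) - x.2 - p * x.1) := by
  have hω : ωp ≠ 0 := hωp.ne_zero hp.ne'
  have hp' : (p : ℤ) ≠ 0 := by exact_mod_cast hp.ne'
  have hpc : (p : ℂ) ≠ 0 := by exact_mod_cast hp.ne'
  set e : ℤ × ℕ → ℤ × ℤ := fun q => (-n - 1 - q.2, q.1) with he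
  have hinj : Function.Injective e := by
    rintro ⟨x, i⟩ ⟨y, j⟩ h
    simp only [he, Prod.mk.injEq] at h
    ext
    · exact h.2
    · simp only; omega
  set H : ℤ × ℤ → M := fun x => F x.1 x.2 ((-a - b - 2 * p - p * n) - x.2 - p * x.1) with hH
  have hfin := (finite_total_degree hp hF (-a - b - 2 * p - p * n)).preimage hinj.injOn
  have hr : ∀ r : ℕ, ωp ^ (-(r : ℤ) * a) •
        ∑ᶠ i : ℕ, cbinom ((a : ℂ) / (p : ℂ)) i •
          subIterCoeff p ωp F (-(r : ℤ)) (n + i) (a + b - (p : ℤ) * i)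
      = ∑ᶠ q : ℤ × ℕ, ωp ^ ((r : ℤ) * -(a + q.1)) •
          (cbinom ((a : ℂ) / p + (q.1 : ℂ) / p) q.2 • H (e q)) := fun r => by
    have h1 := finsum_cbinom_smul_finsum ((a : ℂ) / p) (fun q : ℤ => (q : ℂ) / p)
      (fun q m => ωp ^ (-(r : ℤ) * q) • H (e (q, m)))
      (hfin.subset fun q hq => right_ne_zero_of_smul hq)
    rw [show ∑ᶠ i : ℕ, cbinom ((a : ℂ) / (p : ℂ)) i •
          subIterCoeff p ωp F (-(r : ℤ)) (n + i) (a + b - (p : ℤ) * i) = _ from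
        Eq.trans (finsum_congr fun i => ?_) h1, smul_finsum]
    · refine finsum_congr fun q => ?_
      rw [smul_smul, smul_smul, smul_smul,
        show (r : ℤ) * -(a + q.1) = -(r : ℤ) * a + -(r : ℤ) * q.1 by ring, zpow_add₀ hω]
      congr 1
      ring
    · rw [subIterCoeff]
      congr 1
      refine finsum_congr fun q => ?_
      rw [smul_smul, mul_comm]
      congr 1
      simp only [hH, he]
      congr 1 <;> push_cast <;> ring
  simp only [hr]
  rw [sum_finsum_zpow_smul hp hωp (fun q : ℤ × ℕ => -(a + q.1)) _
    (hfin.subset fun q hq => right_ne_zero_of_smul hq), ← finsum_comp_eq_of_injective hinj]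
  · refine finsum_congr fun q => ?_
    simp only [he, dvd_neg]
    split_ifs with hd
    · obtain ⟨t, ht⟩ := hd
      rw [ht, Int.mul_ediv_cancel_left _ hp', show -(n + (-n - 1 - (q.2 : ℤ))) - 1 = q.2 by ring,
        cbinomZ_natCast, ← add_div, ← Int.cast_add, ht, Int.cast_mul, Int.cast_natCast,
        mul_div_cancel_left₀ _ hpc]
    · rw [zero_smul]
  · intro x hx
    have hx := left_ne_zero_of_smul hx
    split_ifs at hx with hd
    · have hnn : 0 ≤ -(n + x.1) - 1 := by
        by_contra hneg
        exact hx (cbinomZ_of_neg _ (by omega))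
      refine ⟨(x.2, (-(n + x.1) - 1).toNat), Prod.ext ?_ rfl⟩
      simp only [he, Int.toNat_of_nonneg hnn]
      ring
    · exact absurd rfl hx

/-- The twisted Jacobi identity for the three expansions of one Laurent series. -/
lemma laurent_twisted_jacobi {p : ℕ} (hp : 0 < p) {ωp : ℂ} (hωp : IsPrimitiveRoot ωp p)
    {F : ℤ → ℤ → ℤ → M} (hF : TwIsLaurent3 F) (n a b : ℤ) :
    (∑ᶠ i : ℕ, ((-1 : ℂ) ^ i * cbinom (n : ℂ) i) •
        subUVCoeff p F (a + (p : ℤ) * (n - i)) (b + (p : ℤ) * i))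
      - (-1 : ℂ) ^ n • (∑ᶠ i : ℕ, ((-1 : ℂ) ^ i * cbinom (n : ℂ) i) •
          subVUCoeff p F (a + (p : ℤ) * i) (b + (p : ℤ) * (n - i)))
      = (p : ℂ)⁻¹ • ∑ r ∈ Finset.range p, ωp ^ (-(r : ℤ) * a) •
          (∑ᶠ i : ℕ, cbinom ((a : ℂ) / (p : ℂ)) i •
            subIterCoeff p ωp F (-(r : ℤ)) (n + i) (a + b - (p : ℤ) * i)) := by
  have hfin := finite_total_degree hp hF (-a - b - 2 * p - p * n)
  rw [finsum_subUVCoeff hp hF, finsum_subVUCoeff hp hF, sum_finsum_subIterCoeff hp hωp hF,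
    ← finsum_sub_distrib (hfin.subset fun x hx => right_ne_zero_of_smul hx)
      (hfin.subset fun x hx => right_ne_zero_of_smul hx)]
  refine finsum_congr fun x => ?_
  rw [← sub_smul]
  congr 1
  split_ifs
  · exact cbinomZ_three_term _ _
  · exact sub_zero 0

/-- A truncated family is determined by its twisted binomial sums. -/
lemma eq_zero_of_sum_finsum_eq_zero {p : ℕ} (hp : 0 < p) {ωp : ℂ} (hωp : IsPrimitiveRoot ωp p)
    {D : ℕ → ℤ → ℤ → M} {K : ℤ} (hK : ∀ r < p, ∀ n ≥ K, ∀ c, D r n c = 0)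
    (h : ∀ n a b : ℤ, ∑ r ∈ Finset.range p, ωp ^ (-(r : ℤ) * a) •
      ∑ᶠ i : ℕ, cbinom ((a : ℂ) / (p : ℂ)) i • D r (n + i) (a + b - (p : ℤ) * i) = 0) :
    ∀ r < p, ∀ n c, D r n c = 0 := by
  have key : ∀ d : ℕ, ∀ n : ℤ, K - d ≤ n → ∀ r < p, ∀ c, D r n c = 0 := by
    intro d
    induction d with
    | zero => exact fun n hn r hr => hK r hr n (by simpa using hn)
    | succ d ih =>
      intro n hn r hr c
      refine eq_zero_of_sum_zpow_smul_eq_zero hp hωp (d := fun r => D r n c) (fun a => ?_) hr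
      rw [← h n a (c - a)]
      refine Finset.sum_congr rfl fun r hr => ?_
      rw [finsum_eq_single _ 0]
      · simp [cbinom_zero_right]
      · intro i hi
        rw [ih (n + i) (by push_cast at hn; omega) r (Finset.mem_range.1 hr), smul_zero]
  intro r hr n c
  exact key (K - n).toNat n (by omega) r hr c

/-! ### Clearing the pole in `x₁ - x₂` -/

/-- The coefficient of `x₁^{-A/p-1} x₂^{-B/p-1}` in `(x₁-x₂)^K E(x₁,x₂)`, where `E A B` is the
corresponding coefficient of `E(x₁,x₂)`. -/
def mulDiffPow (p : ℕ) (K : ℤ) (E : ℤ → ℤ → M) (A B : ℤ) : M :=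
  ∑ᶠ i : ℕ, ((-1 : ℂ) ^ i * cbinom (K : ℂ) i) • E (A + (p : ℤ) * (K - i)) (B + (p : ℤ) * i)

/-- The series `x₀^{-K} (x₁-x₂)^K E(x₁,x₂)`. -/
def laurentOfProduct (p : ℕ) (K : ℤ) (E : ℤ → ℤ → M) : ℤ → ℤ → ℤ → M := fun n0 N1 N2 =>
  if n0 = -K then mulDiffPow p K E (-N1 - p) (-N2 - p) else 0

lemma finsum_laurentOfProduct (p : ℕ) (K : ℤ) (E : ℤ → ℤ → M) (c : ℤ → ℕ → ℂ)
    (e₁ e₂ : ℤ → ℕ → ℤ) :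
    ∑ᶠ q : ℤ × ℕ, c q.1 q.2 • laurentOfProduct p K E q.1 (e₁ q.1 q.2) (e₂ q.1 q.2)
      = ∑ᶠ j : ℕ, c (-K) j • mulDiffPow p K E (-e₁ (-K) j - p) (-e₂ (-K) j - p) := by
  have hinj : Function.Injective fun j : ℕ => (-K, j) := fun i j h => (Prod.mk.inj h).2
  rw [← finsum_comp_eq_of_injective hinj]
  · exact finsum_congr fun j => by rw [laurentOfProduct, if_pos rfl]
  · rintro ⟨n, j⟩ hx
    have hx := right_ne_zero_of_smul hx
    simp only [laurentOfProduct] at hx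
    split_ifs at hx with hn
    · exact ⟨j, Prod.ext hn.symm rfl⟩
    · exact absurd rfl hx

lemma subUVCoeff_laurentOfProduct {p : ℕ} (hp : 0 < p) (K : ℤ) {E : ℤ → ℤ → M} {T : ℤ}
    (hE : ∀ A B, T ≤ B → E A B = 0) (A B : ℤ) :
    subUVCoeff p (laurentOfProduct p K E) A B = E A B := by
  have hp' : (1 : ℤ) ≤ p := by exact_mod_cast hp
  have h := finsum_cbinom_smul_finsum_nat (-K : ℂ) K
    (fun m => (-1 : ℂ) ^ m • E (A - p * m) (B + p * m)) (B := (T - B).toNat)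
    (fun m hm => by
      rw [hE _ _ _, smul_zero]
      have : T - B ≤ m := by omega
      nlinarith)
  rw [finsum_eq_single (fun m : ℕ => cbinom (-K + K : ℂ) m • _) 0
    (fun m hm => by rw [neg_add_cancel, cbinom_zero_left hm, zero_smul])] at h
  simp only [cbinom_zero_right, pow_zero, one_smul, Nat.cast_zero, mul_zero, sub_zero,
    add_zero] at h
  rw [← h, subUVCoeff, finsum_laurentOfProduct p K E
    (fun n j => (-1 : ℂ) ^ j * cbinom (n : ℂ) j)
    (fun n j => -A - p - (p : ℤ) * n + (p : ℤ) * j) (fun _ j => -B - p - (p : ℤ) * j)]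
  refine finsum_congr fun j => ?_
  rw [mul_comm, mul_smul, Int.cast_neg, mulDiffPow, smul_finsum]
  congr 1
  refine finsum_congr fun i => ?_
  rw [smul_smul, smul_smul, pow_add]
  congr 1
  · ring
  · congr 1 <;> push_cast <;> ring

lemma subVUCoeff_laurentOfProduct {p : ℕ} (hp : 0 < p) (K : ℤ) {E E' : ℤ → ℤ → M} {S : ℤ}
    (hE' : ∀ A B, S ≤ A → E' A B = 0)
    (hcomm : ∀ A B, mulDiffPow p K E A B = (-1 : ℂ) ^ K •
      ∑ᶠ i : ℕ, ((-1 : ℂ) ^ i * cbinom (K : ℂ) i) • E' (A + (p : ℤ) * i) (B + (p : ℤ) * (K - i)))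
    (A B : ℤ) :
    subVUCoeff p (laurentOfProduct p K E) A B = E' A B := by
  have hp' : (1 : ℤ) ≤ p := by exact_mod_cast hp
  have h := finsum_cbinom_smul_finsum_nat (-K : ℂ) K
    (fun m => (-1 : ℂ) ^ m • E' (A + p * m) (B - p * m)) (B := (S - A).toNat)
    (fun m hm => by
      rw [hE' _ _ _, smul_zero]
      have : S - A ≤ m := by omega
      nlinarith)
  rw [finsum_eq_single (fun m : ℕ => cbinom (-K + K : ℂ) m • _) 0
    (fun m hm => by rw [neg_add_cancel, cbinom_zero_left hm, zero_smul])] at h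
  simp only [cbinom_zero_right, pow_zero, one_smul, Nat.cast_zero, mul_zero, sub_zero,
    add_zero] at h
  rw [← h, subVUCoeff, finsum_laurentOfProduct p K E
    (fun n j => (-1 : ℂ) ^ (n - (j : ℤ)) * cbinom (n : ℂ) j)
    (fun _ j => -A - p - (p : ℤ) * j) (fun n j => -B - p - (p : ℤ) * n + (p : ℤ) * j)]
  refine finsum_congr fun j => ?_
  rw [mul_comm, mul_smul, Int.cast_neg, hcomm,
    smul_smul ((-1 : ℂ) ^ (-K - (j : ℤ)))]
  congr 1
  have hs : (-1 : ℂ) ^ (-K - (j : ℤ)) * (-1) ^ K = (-1) ^ j := by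
    rw [← zpow_natCast, ← zpow_add₀ (by norm_num)]
    exact neg_one_zpow_eq_of_even_sub ⟨-j, by ring⟩
  rw [hs, smul_finsum]
  refine finsum_congr fun i => ?_
  rw [smul_smul, smul_smul, pow_add]
  congr 1
  · ring
  · congr 1 <;> push_cast <;> ring

lemma laurentOfProduct_eq_zero_of_snd {p : ℕ} {K : ℤ} {E : ℤ → ℤ → M} {T : ℤ}
    (hE : ∀ A B, T ≤ B → E A B = 0) {n0 N1 N2 : ℤ} (h : N2 < -(T + p)) :
    laurentOfProduct p K E n0 N1 N2 = 0 := by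
  rw [laurentOfProduct]
  split_ifs
  · rw [mulDiffPow, finsum_eq_zero_of_forall_eq_zero]
    intro i
    rw [hE _ _ _, smul_zero]
    have : (0 : ℤ) ≤ p * i := by positivity
    omega
  · rfl

lemma laurentOfProduct_eq_zero_of_fst {p : ℕ} {K : ℤ} {E E' : ℤ → ℤ → M} {S : ℤ}
    (hE' : ∀ A B, S ≤ A → E' A B = 0)
    (hcomm : ∀ A B, mulDiffPow p K E A B = (-1 : ℂ) ^ K •
      ∑ᶠ i : ℕ, ((-1 : ℂ) ^ i * cbinom (K : ℂ) i) • E' (A + (p : ℤ) * i) (B + (p : ℤ) * (K - i)))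
    {n0 N1 N2 : ℤ} (h : N1 < -(S + p)) :
    laurentOfProduct p K E n0 N1 N2 = 0 := by
  rw [laurentOfProduct]
  split_ifs
  · rw [hcomm, finsum_eq_zero_of_forall_eq_zero, smul_zero]
    intro i
    rw [hE' _ _ _, smul_zero]
    have : (0 : ℤ) ≤ p * i := by positivity
    omega
  · rfl

lemma subIterCoeff_laurentOfProduct_eq_zero {p : ℕ} {ωp : ℂ} {K : ℤ} {E : ℤ → ℤ → M}
    {s n c : ℤ} (h : K ≤ n) : subIterCoeff p ωp (laurentOfProduct p K E) s n c = 0 := by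
  rw [subIterCoeff, finsum_eq_zero_of_forall_eq_zero]
  intro q
  rw [laurentOfProduct, if_neg (by omega), smul_zero]

/-! ### The substitution identities in terms of coefficients -/

lemma twSubUV_iff {p : ℕ} {YM : V →ₗ[ℂ] ℤ → Module.End ℂ M} {u v : V} {w : M}
    {F : ℤ → ℤ → ℤ → M} :
    TwSubUV p YM u v w F ↔ ∀ A B, subUVCoeff p F A B = YM u A (YM v B w) := by
  refine ⟨fun h A B => ?_, fun h N1 N2 => ?_⟩
  · simpa [subUVCoeff] using (h (-A - p) (-B - p)).symm
  · simpa [subUVCoeff] using (h (-N1 - p) (-N2 - p)).symm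

lemma twSubVU_iff {p : ℕ} {YM : V →ₗ[ℂ] ℤ → Module.End ℂ M} {u v : V} {w : M}
    {F : ℤ → ℤ → ℤ → M} :
    TwSubVU p YM u v w F ↔ ∀ A B, subVUCoeff p F A B = YM v B (YM u A w) := by
  refine ⟨fun h A B => ?_, fun h N1 N2 => ?_⟩
  · simpa [subVUCoeff] using (h (-A - p) (-B - p)).symm
  · simpa [subVUCoeff] using (h (-N1 - p) (-N2 - p)).symm

lemma twSubIter_iff {p : ℕ} {𝒜 : VOA V} {ν : V ≃ₗ[ℂ] V} {ωp : ℂ}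
    {YM : V →ₗ[ℂ] ℤ → Module.End ℂ M} {u v : V} {w : M} {F : ℤ → ℤ → ℤ → M} :
    TwSubIter p 𝒜 ν ωp YM u v w F ↔
      ∀ s n c, subIterCoeff p ωp F s n c = YM (𝒜.Y ((ν ^ (-s)) u) n v) c w := by
  refine ⟨fun h s n c => ?_, fun h s n N2 => ?_⟩
  · simpa [subIterCoeff] using (h s (-n - 1) (-c - p)).symm
  · simpa [subIterCoeff] using (h s (-n - 1) (-N2 - p)).symm

/-- By periodicity it suffices to check the iterate identity for `s = 0, -1, …, -(p-1)`. -/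
lemma twSubIter_of_forall_lt {p : ℕ} (hp : 0 < p) {𝒜 : VOA V} {ν : V ≃ₗ[ℂ] V}
    (hν : ν ^ p = 1) {ωp : ℂ} (hωp : IsPrimitiveRoot ωp p)
    {YM : V →ₗ[ℂ] ℤ → Module.End ℂ M} {u v : V} {w : M} {F : ℤ → ℤ → ℤ → M}
    (h : ∀ r < p, ∀ n c,
      subIterCoeff p ωp F (-(r : ℤ)) n c = YM (𝒜.Y ((ν ^ r) u) n v) c w) :
    TwSubIter p 𝒜 ν ωp YM u v w F := by
  rw [twSubIter_iff]
  intro s n c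
  have hp' : (0 : ℤ) < p := by exact_mod_cast hp
  have hω : ωp ≠ 0 := hωp.ne_zero hp.ne'
  obtain ⟨r, hr⟩ : ∃ r : ℕ, (r : ℤ) = -s % p :=
    ⟨(-s % p).toNat, Int.toNat_of_nonneg (Int.emod_nonneg _ hp'.ne')⟩
  have hs : -s = p * (-s / p) + r := by rw [hr, Int.mul_ediv_add_emod]
  have hrp : r < p := by
    have := Int.emod_lt_of_pos (-s) hp'
    omega
  have hν' : ν ^ (-s) = ν ^ r := by
    rw [hs, zpow_add, zpow_mul, zpow_natCast, hν, one_zpow, one_mul, zpow_natCast]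
  rw [hν', ← h r hrp n c, subIterCoeff, subIterCoeff]
  refine finsum_congr fun q => ?_
  congr 2
  rw [show s * q.1 = p * (-(-s / p) * q.1) + -(r : ℤ) * q.1 by linear_combination -q.1 * hs,
    zpow_add₀ hω, zpow_mul, zpow_natCast, hωp.pow_eq_one, one_zpow, one_mul]

lemma exists_trunc_iterates (p : ℕ) (𝒜 : VOA V) (ν : V ≃ₗ[ℂ] V) (u v : V) :
    ∃ k : ℕ, ∀ r < p, ∀ n : ℤ, (k : ℤ) ≤ n → 𝒜.Y ((ν ^ r) u) n v = 0 := by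
  choose N hN using fun r : ℕ => 𝒜.trunc ((ν ^ r) u) v
  refine ⟨(Finset.range p).sup fun r => (N r).toNat, fun r hr n hn => hN r n ?_⟩
  have := Finset.le_sup (f := fun r => (N r).toNat) (Finset.mem_range.2 hr)
  omega

lemma exists_laurent_of_twJacobi {p : ℕ} (hp : 0 < p) {𝒜 : VOA V} {ν : V ≃ₗ[ℂ] V}
    (hν : ν ^ p = 1) {ωp : ℂ} (hωp : IsPrimitiveRoot ωp p)
    {YM : V →ₗ[ℂ] ℤ → Module.End ℂ M} (hJ : TwJacobi p 𝒜 ν ωp YM) {u v : V} {w : M} {k : ℕ}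
    (hk : ∀ r < p, ∀ n : ℤ, (k : ℤ) ≤ n → 𝒜.Y ((ν ^ r) u) n v = 0) {S T : ℤ}
    (hS : ∀ n ≥ S, YM u n w = 0) (hT : ∀ n ≥ T, YM v n w = 0) :
    ∃ F : ℤ → ℤ → ℤ → M, TwIsLaurent3 F ∧ TwPole0 k F ∧ TwPole1 (S + p).toNat F ∧
      TwSubUV p YM u v w F ∧ TwSubVU p YM u v w F ∧ TwSubIter p 𝒜 ν ωp YM u v w F := by
  set E : ℤ → ℤ → M := fun A B => YM u A (YM v B w)
  set E' : ℤ → ℤ → M := fun A B => YM v B (YM u A w)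
  have hE : ∀ A B, T ≤ B → E A B = 0 := fun A B hB => by simp [E, hT B hB]
  have hE' : ∀ A B, S ≤ A → E' A B = 0 := fun A B hA => by simp [E', hS A hA]
  have hcomm : ∀ A B, mulDiffPow p k E A B = (-1 : ℂ) ^ (k : ℤ) •
      ∑ᶠ i : ℕ, ((-1 : ℂ) ^ i * cbinom ((k : ℤ) : ℂ) i) •
        E' (A + (p : ℤ) * i) (B + (p : ℤ) * (k - i)) := by
    intro A B
    refine sub_eq_zero.1 ((hJ u v w k A B).trans ?_)
    rw [Finset.sum_eq_zero, smul_zero]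
    intro r hr
    rw [finsum_eq_zero_of_forall_eq_zero, smul_zero]
    intro i
    rw [hk r (Finset.mem_range.1 hr) _ (by omega)]
    simp
  set F := laurentOfProduct p k E
  have hP0 : TwPole0 k F := fun n0 N1 N2 h => if_neg (by omega)
  have hP1 : TwPole1 (S + p).toNat F := fun n0 N1 N2 h =>
    laurentOfProduct_eq_zero_of_fst hE' hcomm (by omega)
  have hF : TwIsLaurent3 F := by
    refine ⟨k + (S + p).toNat + (T + p).toNat, ?_⟩
    rintro n0 N1 N2 (h | h | h)
    · exact hP0 _ _ _ (by omega)
    · exact hP1 _ _ _ (by omega)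
    · exact laurentOfProduct_eq_zero_of_snd hE (by omega)
  have hUV : ∀ A B, subUVCoeff p F A B = E A B := subUVCoeff_laurentOfProduct hp k hE
  have hVU : ∀ A B, subVUCoeff p F A B = E' A B := subVUCoeff_laurentOfProduct hp k hE' hcomm
  refine ⟨F, hF, hP0, hP1, twSubUV_iff.2 hUV, twSubVU_iff.2 hVU,
    twSubIter_of_forall_lt hp hν hωp fun r hr n c => sub_eq_zero.1 ?_⟩
  have hFz : ∀ s n c : ℤ, (k : ℤ) ≤ n → subIterCoeff p ωp F s n c = 0 := fun s n c h =>
    subIterCoeff_laurentOfProduct_eq_zero h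
  have hYz : ∀ r < p, ∀ n c : ℤ, (k : ℤ) ≤ n → YM (𝒜.Y ((ν ^ r) u) n v) c w = 0 :=
    fun r hr n c h => by simp [hk r hr n h]
  refine eq_zero_of_sum_finsum_eq_zero hp hωp (K := k)
    (D := fun r n c => subIterCoeff p ωp F (-(r : ℤ)) n c - YM (𝒜.Y ((ν ^ r) u) n v) c w)
    (fun r hr n hn c => by simp only [hFz _ _ _ hn, hYz r hr _ _ hn, sub_zero])
    (fun n a b => ?_) r hr n c
  have hsupp : ∀ f : ℕ → M, (∀ i : ℕ, (k : ℤ) ≤ n + i → f i = 0) →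
      (Function.support f).Finite := fun f hf =>
    (Set.finite_Iio (k - n).toNat).subset fun i hi => by
      by_contra hlt
      exact hi (hf i (by simp only [Set.mem_Iio] at hlt; omega))
  have h1 := laurent_twisted_jacobi hp hωp hF n a b
  simp only [hUV, hVU] at h1
  have h2 := h1.symm.trans (hJ u v w n a b)
  have h3 := sub_eq_zero.2 (smul_right_injective M (inv_ne_zero
    (by exact_mod_cast hp.ne' : (p : ℂ) ≠ 0)) h2)
  rw [← Finset.sum_sub_distrib] at h3
  rw [← h3]
  refine Finset.sum_congr rfl fun r hr => ?_
  rw [← smul_sub, ← finsum_sub_distrib]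
  · simp only [smul_sub]
  · exact hsupp _ fun i hi => by rw [hFz _ _ _ hi, smul_zero]
  · exact hsupp _ fun i hi => by rw [hYz r (Finset.mem_range.1 hr) _ _ hi, smul_zero]

lemma twJacobi_of_exists_laurent {p : ℕ} (hp : 0 < p) {𝒜 : VOA V} {ν : V ≃ₗ[ℂ] V}
    {ωp : ℂ} (hωp : IsPrimitiveRoot ωp p) {YM : V →ₗ[ℂ] ℤ → Module.End ℂ M}
    (h : ∀ (u v : V) (w : M), ∃ F : ℤ → ℤ → ℤ → M, TwIsLaurent3 F ∧
      TwSubUV p YM u v w F ∧ TwSubVU p YM u v w F ∧ TwSubIter p 𝒜 ν ωp YM u v w F) :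
    TwJacobi p 𝒜 ν ωp YM := by
  intro u v w n a b
  obtain ⟨F, hF, hUV, hVU, hIt⟩ := h u v w
  rw [twSubUV_iff] at hUV
  rw [twSubVU_iff] at hVU
  rw [twSubIter_iff] at hIt
  simpa only [hUV, hVU, hIt, neg_neg, zpow_natCast] using laurent_twisted_jacobi hp hωp hF n a b


/-- Theorem 4.7, formal commutativity and associativity for twisted
modules.  Forward direction: truncation and the twisted Jacobi identity imply the
existence, for every `u, v, w`, of `k(u,v) ∈ ℕ`, `l(u,w) = L(u,w)/p ∈ (1/p)ℕ` and
`F ∈ M((x₀,x₁^{1/p},x₂^{1/p}))` with the pole conditions and substitution identities.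
Converse: truncation together with the existence of such data (exponents allowed to
depend on all of `u, v, w`) imply the twisted Jacobi identity. -/
theorem statement3 (p : ℕ) (hp : 0 < p) (𝒜 : VOA V) (ν : V ≃ₗ[ℂ] V)
    (hν_vac : ν 𝒜.vac = 𝒜.vac) (hν_conf : ν 𝒜.conf = 𝒜.conf)
    (hν_Y : ∀ (u : V) (n : ℤ) (v : V), ν (𝒜.Y u n v) = 𝒜.Y (ν u) n (ν v))
    (hν_per : ν ^ p = 1) (ωp : ℂ) (hωp : IsPrimitiveRoot ωp p)
    (YM : V →ₗ[ℂ] ℤ → Module.End ℂ M) :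
    (TwTrunc YM → TwJacobi p 𝒜 ν ωp YM →
      ∃ (k : V → V → ℕ) (L : V → M → ℕ),
        ∀ (u v : V) (w : M), ∃ F : ℤ → ℤ → ℤ → M,
          TwIsLaurent3 F ∧ TwPole0 (k u v) F ∧ TwPole1 (L u w) F ∧
          TwSubUV p YM u v w F ∧ TwSubVU p YM u v w F ∧ TwSubIter p 𝒜 ν ωp YM u v w F)
    ∧ (TwTrunc YM →
       (∀ (u v : V) (w : M), ∃ (k L : ℕ) (F : ℤ → ℤ → ℤ → M),
          TwIsLaurent3 F ∧ TwPole0 k F ∧ TwPole1 L F ∧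
          TwSubUV p YM u v w F ∧ TwSubVU p YM u v w F ∧ TwSubIter p 𝒜 ν ωp YM u v w F) →
       TwJacobi p 𝒜 ν ωp YM) := by
  refine ⟨fun hT hJ => ?_, fun _ h => twJacobi_of_exists_laurent hp hωp fun u v w => ?_⟩
  · choose k hk using exists_trunc_iterates p 𝒜 ν
    choose S hS using hT
    exact ⟨k, fun u w => (S u w + p).toNat, fun u v w =>
      exists_laurent_of_twJacobi hp hν_per hωp hJ (hk u v) (hS u w) (hS v w)⟩
  · obtain ⟨_, _, F, hF, _, _, hUV, hVU, hIt⟩ := h u v w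
    exact ⟨F, hF, hUV, hVU, hIt⟩

end S3
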